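/- Let F, ξ : ℝ² → ℂ be C¹. The Jacobian determinant of the map Φ : ℝ³ → ℝ³, (u,v,r) ↦ (Re z, Im z, t) defined by z = (2(F − conj(F)ξ²) + 2ξ(1+ξconj(ξ))r)/(1+ξconj(ξ))² and t = (−2(F·conj(ξ) + conj(F)·ξ) + (1 − ξ²conj(ξ)²)r)/(1+ξconj(ξ))², equals Δ = 4(∂⁺F·conj(∂⁺F) − ∂⁻F·conj(∂⁻F))/(1+ξconj(ξ))². In particular Φ is a local diffeomorphism at every point where ∂⁺F·conj(∂⁺F) ≠ ∂⁻F·conj(∂⁻F). -/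

import Mathlib

open Complex
open scoped ComplexConjugate

/-- Wirtinger derivative ∂ = (1/2)(∂/∂u − i ∂/∂v). -/
noncomputable def wd (f : ℝ × ℝ → ℂ) (p : ℝ × ℝ) : ℂ :=
  (1 / 2) * (fderiv ℝ f p (1, 0) - Complex.I * fderiv ℝ f p (0, 1))

/-- Wirtinger derivative ∂̄ = (1/2)(∂/∂u + i ∂/∂v). -/
noncomputable def wdb (f : ℝ × ℝ → ℂ) (p : ℝ × ℝ) : ℂ :=
  (1 / 2) * (fderiv ℝ f p (1, 0) + Complex.I * fderiv ℝ f p (0, 1))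

/-- ∂⁺F = ∂F + r·∂ξ − 2F·conj(ξ)·∂ξ/(1+ξ·conj(ξ)). -/
noncomputable def dplus (F ξ : ℝ × ℝ → ℂ) (r : ℝ) (p : ℝ × ℝ) : ℂ :=
  wd F p + r * wd ξ p - 2 * F p * conj (ξ p) * wd ξ p / (1 + ξ p * conj (ξ p))

/-- ∂⁻F = ∂̄F + r·∂̄ξ − 2F·conj(ξ)·∂̄ξ/(1+ξ·conj(ξ)). -/
noncomputable def dminus (F ξ : ℝ × ℝ → ℂ) (r : ℝ) (p : ℝ × ℝ) : ℂ :=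
  wdb F p + r * wdb ξ p - 2 * F p * conj (ξ p) * wdb ξ p / (1 + ξ p * conj (ξ p))

/-- The complex coordinate z = (2(F − conj(F)ξ²) + 2ξ(1+ξconj(ξ))r)/(1+ξconj(ξ))². -/
noncomputable def zC (F ξ : ℝ × ℝ → ℂ) (p : ℝ × ℝ) (r : ℝ) : ℂ :=
  (2 * (F p - conj (F p) * (ξ p) ^ 2) + 2 * ξ p * (1 + ξ p * conj (ξ p)) * r) /
    (1 + ξ p * conj (ξ p)) ^ 2

/-- t = (−2(F·conj(ξ) + conj(F)·ξ) + (1 − ξ²conj(ξ)²)r)/(1+ξconj(ξ))² (a real number,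
written as a complex expression). -/
noncomputable def tC (F ξ : ℝ × ℝ → ℂ) (p : ℝ × ℝ) (r : ℝ) : ℂ :=
  (-2 * (F p * conj (ξ p) + conj (F p) * ξ p) + (1 - (ξ p) ^ 2 * (conj (ξ p)) ^ 2) * r) /
    (1 + ξ p * conj (ξ p)) ^ 2

/-- The congruence coordinate map Φ : (u,v,r) ↦ (Re z, Im z, t). -/
noncomputable def Phi (F ξ : ℝ × ℝ → ℂ) (w : ℝ × ℝ × ℝ) : ℝ × ℝ × ℝ :=
  ((zC F ξ (w.1, w.2.1) w.2.2).re, (zC F ξ (w.1, w.2.1) w.2.2).im,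
    (tC F ξ (w.1, w.2.1) w.2.2).re)

theorem one_add_mul_conj_ne_zero (x : ℂ) : 1 + x * conj x ≠ 0 := by
  rw [Complex.mul_conj, ← Complex.ofReal_one, ← Complex.ofReal_add, Complex.ofReal_ne_zero]
  have := Complex.normSq_nonneg x
  positivity

/-- The determinant of an endomorphism of `ℝ × ℝ × ℝ`, as the triple product of its columns. -/
theorem det_linearMap_prod_prod (L : ℝ × ℝ × ℝ →ₗ[ℝ] ℝ × ℝ × ℝ) :
    L.det =
      (L (1, 0, 0)).1 *
          ((L (0, 1, 0)).2.1 * (L (0, 0, 1)).2.2 - (L (0, 0, 1)).2.1 * (L (0, 1, 0)).2.2) -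
        (L (0, 1, 0)).1 *
          ((L (1, 0, 0)).2.1 * (L (0, 0, 1)).2.2 - (L (0, 0, 1)).2.1 * (L (1, 0, 0)).2.2) +
        (L (0, 0, 1)).1 *
          ((L (1, 0, 0)).2.1 * (L (0, 1, 0)).2.2 - (L (0, 1, 0)).2.1 * (L (1, 0, 0)).2.2) := by
  let φ : (ℝ × ℝ × ℝ) ≃ₗ[ℝ] (Fin 3 → ℝ) :=
    { toFun := fun x => ![x.1, x.2.1, x.2.2]
      invFun := fun y => (y 0, y 1, y 2)
      map_add' := fun x y => by ext i; fin_cases i <;> rfl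
      map_smul' := fun c x => by ext i; fin_cases i <;> rfl
      left_inv := fun x => rfl
      right_inv := fun y => by ext i; fin_cases i <;> rfl }
  let b := Module.Basis.ofEquivFun φ
  have hb (i : Fin 3) : b i = φ.symm (Pi.single i 1) := by simp [b]
  have hsymm (y : Fin 3 → ℝ) : φ.symm y = (y 0, y 1, y 2) := rfl
  have h0 : b 0 = (1, 0, 0) := (hb 0).trans (by simp [hsymm])
  have h1 : b 1 = (0, 1, 0) := (hb 1).trans (by simp [hsymm])
  have h2 : b 2 = (0, 0, 1) := (hb 2).trans (by simp [hsymm])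
  have hr (x : ℝ × ℝ × ℝ) : (b.repr x : Fin 3 → ℝ) = ![x.1, x.2.1, x.2.2] := by
    rw [← Module.Basis.equivFun_apply, Module.Basis.equivFun_ofEquivFun]
    rfl
  rw [← LinearMap.det_toMatrix b, Matrix.det_fin_three]
  simp only [LinearMap.toMatrix_apply, h0, h1, h2, hr, Matrix.cons_val]
  ring

/-- A `C¹` self-map of a finite-dimensional space is a local `C¹` diffeomorphism near any point
where its Jacobian determinant does not vanish. -/
theorem exists_openPartialHomeomorph_of_det_ne_zero {E : Type*} [NormedAddCommGroup E]
    [NormedSpace ℝ E] [FiniteDimensional ℝ E] {f : E → E} (hf : ContDiff ℝ 1 f) {w : E}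
    (hw : (fderiv ℝ f w).det ≠ 0) :
    ∃ e : OpenPartialHomeomorph E E, w ∈ e.source ∧ (e : E → E) = f ∧
      ContDiffOn ℝ 1 e e.source ∧ ContDiffOn ℝ 1 e.symm e.target := by
  have : CompleteSpace E := FiniteDimensional.complete ℝ E
  have hder (x : E) (hx : (fderiv ℝ f x).det ≠ 0) : HasFDerivAt f
      ((fderiv ℝ f x).toContinuousLinearEquivOfDetNeZero hx : E →L[ℝ] E) x := by
    rw [ContinuousLinearMap.coe_toContinuousLinearEquivOfDetNeZero]
    exact (hf.differentiable one_ne_zero x).hasFDerivAt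
  have hopen : IsOpen {x | (fderiv ℝ f x).det ≠ 0} :=
    isOpen_ne.preimage
      (ContinuousLinearMap.continuous_det.comp (hf.continuous_fderiv one_ne_zero))
  let e₀ := hf.contDiffAt.toOpenPartialHomeomorph f (hder w hw) one_ne_zero
  have he₀ : (e₀ : E → E) = f := ContDiffAt.toOpenPartialHomeomorph_coe ..
  let e := e₀.restrOpen _ hopen
  have he : (e : E → E) = f := he₀
  refine ⟨e, ⟨ContDiffAt.mem_toOpenPartialHomeomorph_source .., hw⟩, he, ?_, ?_⟩
  · rw [he]
    exact hf.contDiffOn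
  · intro y hy
    have hx : e.symm y ∈ e.source := e.map_target hy
    refine (e.contDiffAt_symm hy (f₀' := ContinuousLinearMap.toContinuousLinearEquivOfDetNeZero
      (fderiv ℝ f (e.symm y)) hx.2) ?_ ?_).contDiffWithinAt
    · rw [he]
      exact hder _ hx.2
    · rw [he]
      exact hf.contDiffAt

theorem contDiff_Phi {F ξ : ℝ × ℝ → ℂ} (hF : ContDiff ℝ 1 F) (hξ : ContDiff ℝ 1 ξ) :
    ContDiff ℝ 1 (Phi F ξ) := by
  have hp : ContDiff ℝ 1 (fun w : ℝ × ℝ × ℝ => (w.1, w.2.1)) := by fun_prop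
  have hf := hF.comp hp
  have hx := hξ.comp hp
  have hfb := conjCLE.contDiff.comp hf
  have hxb := conjCLE.contDiff.comp hx
  have hr : ContDiff ℝ 1 (fun w : ℝ × ℝ × ℝ => (w.2.2 : ℂ)) :=
    ofRealCLM.contDiff.comp (by fun_prop)
  have hD := ((contDiff_const (c := (1 : ℂ))).add (hx.mul hxb)).pow 2
  have hD0 (w : ℝ × ℝ × ℝ) := pow_ne_zero 2 (one_add_mul_conj_ne_zero (ξ (w.1, w.2.1)))
  have hz : ContDiff ℝ 1 (fun w : ℝ × ℝ × ℝ => zC F ξ (w.1, w.2.1) w.2.2) :=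
    (((contDiff_const (c := (2 : ℂ))).mul (hf.sub (hfb.mul (hx.pow 2)))).add
      ((((contDiff_const (c := (2 : ℂ))).mul hx).mul
        ((contDiff_const (c := (1 : ℂ))).add (hx.mul hxb))).mul hr)).mul (hD.inv hD0)
  have ht : ContDiff ℝ 1 (fun w : ℝ × ℝ × ℝ => tC F ξ (w.1, w.2.1) w.2.2) :=
    (((contDiff_const (c := (-2 : ℂ))).mul ((hf.mul hxb).add (hfb.mul hx))).add
      (((contDiff_const (c := (1 : ℂ))).sub ((hx.pow 2).mul (hxb.pow 2))).mul hr)).mul (hD.inv hD0)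
  exact (reCLM.contDiff.comp hz).prodMk
    ((imCLM.contDiff.comp hz).prodMk (reCLM.contDiff.comp ht))

/-- Twice the projection of the vector with complex horizontal part `ζ` and height `τ` orthogonally
to the direction `x`, in the complex coordinate of the tangent plane. -/
noncomputable def perp (x ζ τ : ℂ) : ℂ := (ζ - 2 * τ * x - conj ζ * x ^ 2) / 2

/-- The derivative of `zC` along a curve with data `f, x, r` and velocities `f', x', r'`. -/
noncomputable def zVel (f x r f' x' r' : ℂ) : ℂ :=
  ((2 * (f' - (conj f' * x ^ 2 + conj f * (2 * x * x'))) +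
      (2 * x' * (1 + x * conj x) + 2 * x * (x' * conj x + x * conj x')) * r +
      2 * x * (1 + x * conj x) * r') * (1 + x * conj x) -
    (2 * (f - conj f * x ^ 2) + 2 * x * (1 + x * conj x) * r) *
      (2 * (x' * conj x + x * conj x'))) / (1 + x * conj x) ^ 3

/-- The derivative of `tC` along a curve with data `f, x, r` and velocities `f', x', r'`. -/
noncomputable def tVel (f x r f' x' r' : ℂ) : ℂ :=
  ((-2 * (f' * conj x + f * conj x' + (conj f' * x + conj f * x')) -
      (2 * x * x' * conj x ^ 2 + x ^ 2 * (2 * conj x * conj x')) * r +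
      (1 - x ^ 2 * conj x ^ 2) * r') * (1 + x * conj x) -
    (-2 * (f * conj x + conj f * x) + (1 - x ^ 2 * conj x ^ 2) * r) *
      (2 * (x' * conj x + x * conj x'))) / (1 + x * conj x) ^ 3

theorem conj_tVel (f x f' x' : ℂ) (r r' : ℝ) :
    conj (tVel f x r f' x' r') = tVel f x r f' x' r' := by
  simp only [tVel, map_div₀, map_mul, map_add, map_sub, map_neg, map_pow, map_one, map_ofNat,
    conj_conj, conj_ofReal]
  ring

theorem perp_vel (f x f' x' : ℂ) (r : ℝ) :
    perp x (zVel f x r f' x' 0) (tVel f x r f' x' 0) =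
      f' + r * x' - 2 * f * conj x * x' / (1 + x * conj x) := by
  have hD := one_add_mul_conj_ne_zero x
  have hD' : 1 + conj x * x ≠ 0 := by rwa [mul_comm]
  simp only [perp, zVel, tVel, map_div₀, map_mul, map_add, map_sub, map_pow, map_one,
    map_ofNat, map_zero, conj_conj, conj_ofReal]
  rw [mul_comm (conj x) x]
  field_simp
  ring

theorem hasDerivAt_zC_tC {F ξ : ℝ × ℝ → ℂ} (hF : ContDiff ℝ 1 F) (hξ : ContDiff ℝ 1 ξ)
    (w e : ℝ × ℝ × ℝ) :
    HasDerivAt (fun s : ℝ => zC F ξ ((w + s • e).1, (w + s • e).2.1) (w + s • e).2.2)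
      (zVel (F (w.1, w.2.1)) (ξ (w.1, w.2.1)) w.2.2 (fderiv ℝ F (w.1, w.2.1) (e.1, e.2.1))
        (fderiv ℝ ξ (w.1, w.2.1) (e.1, e.2.1)) e.2.2) 0 ∧
    HasDerivAt (fun s : ℝ => tC F ξ ((w + s • e).1, (w + s • e).2.1) (w + s • e).2.2)
      (tVel (F (w.1, w.2.1)) (ξ (w.1, w.2.1)) w.2.2 (fderiv ℝ F (w.1, w.2.1) (e.1, e.2.1))
        (fderiv ℝ ξ (w.1, w.2.1) (e.1, e.2.1)) e.2.2) 0 := by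
  have hline (a b : ℝ) : HasDerivAt (fun s : ℝ => a + s * b) b 0 := by
    simpa using ((hasDerivAt_id (0 : ℝ)).mul_const b).const_add a
  have hp : HasDerivAt (fun s : ℝ => ((w + s • e).1, (w + s • e).2.1)) (e.1, e.2.1) 0 :=
    (hline _ _).prodMk (hline _ _)
  have hp0 : (((w + (0 : ℝ) • e).1, (w + (0 : ℝ) • e).2.1) : ℝ × ℝ) = (w.1, w.2.1) := by simp
  have hr : HasDerivAt (fun s : ℝ => (((w + s • e).2.2 : ℝ) : ℂ)) (e.2.2 : ℂ) 0 :=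
    (hline _ _).ofReal_comp
  have hcomp {G : ℝ × ℝ → ℂ} (hG : ContDiff ℝ 1 G) :
      HasDerivAt (fun s : ℝ => G ((w + s • e).1, (w + s • e).2.1))
        (fderiv ℝ G (w.1, w.2.1) (e.1, e.2.1)) 0 := by
    refine HasFDerivAt.comp_hasDerivAt (0 : ℝ) (l := G) ?_ hp
    rw [hp0]
    exact (hG.differentiable one_ne_zero _).hasFDerivAt
  have hf := hcomp hF
  have hx := hcomp hξ
  have hconj {g : ℝ → ℂ} {g' : ℂ} (hg : HasDerivAt g g' 0) :
      HasDerivAt (fun s => conj (g s)) (conj g') 0 :=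
    conjCLE.toContinuousLinearMap.hasFDerivAt.comp_hasDerivAt (0 : ℝ) hg
  have hfb := hconj hf
  have hxb := hconj hx
  have hD0 := one_add_mul_conj_ne_zero (ξ (w.1, w.2.1))
  have hD := ((hx.mul hxb).const_add 1)
  have hD20 : (1 + ξ ((w + (0 : ℝ) • e).1, (w + (0 : ℝ) • e).2.1) *
      conj (ξ ((w + (0 : ℝ) • e).1, (w + (0 : ℝ) • e).2.1))) ^ 2 ≠ 0 :=
    pow_ne_zero 2 (one_add_mul_conj_ne_zero _)
  constructor
  · have h := ((((hf.sub (hfb.mul (hx.pow 2))).const_mul 2).add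
      (((hx.const_mul 2).mul hD).mul hr)).div (hD.pow 2) hD20)
    refine h.congr_deriv ?_
    simp only [zVel, Pi.mul_apply, Pi.add_apply, Pi.sub_apply, Pi.pow_apply, zero_smul, add_zero]
    field_simp
    ring
  · have h := ((((hf.mul hxb).add (hfb.mul hx)).const_mul (-2)).add
      ((((hx.pow 2).mul (hxb.pow 2)).const_sub 1).mul hr)).div (hD.pow 2) hD20
    refine h.congr_deriv ?_
    simp only [tVel, Pi.mul_apply, Pi.add_apply, Pi.pow_apply, zero_smul, add_zero]
    rw [div_eq_div_iff (pow_ne_zero 2 (pow_ne_zero 2 hD0)) (pow_ne_zero 3 hD0)]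
    ring

theorem fderiv_Phi_apply {F ξ : ℝ × ℝ → ℂ} (hF : ContDiff ℝ 1 F) (hξ : ContDiff ℝ 1 ξ)
    (w e : ℝ × ℝ × ℝ) {ζ τ : ℂ}
    (hζ : zVel (F (w.1, w.2.1)) (ξ (w.1, w.2.1)) w.2.2 (fderiv ℝ F (w.1, w.2.1) (e.1, e.2.1))
        (fderiv ℝ ξ (w.1, w.2.1) (e.1, e.2.1)) e.2.2 = ζ)
    (hτ : tVel (F (w.1, w.2.1)) (ξ (w.1, w.2.1)) w.2.2 (fderiv ℝ F (w.1, w.2.1) (e.1, e.2.1))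
        (fderiv ℝ ξ (w.1, w.2.1) (e.1, e.2.1)) e.2.2 = τ) :
    fderiv ℝ (Phi F ξ) w e = (ζ.re, ζ.im, τ.re) := by
  obtain ⟨hz, ht⟩ := hasDerivAt_zC_tC hF hξ w e
  rw [hζ] at hz
  rw [hτ] at ht
  have h1 : HasDerivAt (fun s : ℝ => Phi F ξ (w + s • e)) (ζ.re, ζ.im, τ.re) 0 :=
    (reCLM.hasFDerivAt.comp_hasDerivAt (0 : ℝ) hz).prodMk
      ((imCLM.hasFDerivAt.comp_hasDerivAt (0 : ℝ) hz).prodMk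
        (reCLM.hasFDerivAt.comp_hasDerivAt (0 : ℝ) ht))
  have h2 := ((contDiff_Phi hF hξ).differentiable one_ne_zero w).hasFDerivAt.hasLineDerivAt e
  exact h2.unique h1

/-- The triple product of two vectors with the unit vector in the direction `x`, in terms of their
projections orthogonal to that direction. -/
theorem triple_product_eq (x ζ₁ ζ₂ : ℂ) (τ₁ τ₂ : ℝ) (g₁ g₂ : ℂ)
    (h₁ : perp x ζ₁ τ₁ = g₁) (h₂ : perp x ζ₂ τ₂ = g₂) :
    ζ₁.re * (ζ₂.im * ((1 - normSq x) / (1 + normSq x)) - (2 * x.im / (1 + normSq x)) * τ₂) -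
        ζ₂.re * (ζ₁.im * ((1 - normSq x) / (1 + normSq x)) - (2 * x.im / (1 + normSq x)) * τ₁) +
        (2 * x.re / (1 + normSq x)) * (ζ₁.im * τ₂ - ζ₂.im * τ₁) =
      4 * (g₁.re * g₂.im - g₁.im * g₂.re) / (1 + normSq x) ^ 2 := by
  have hD : 1 + normSq x ≠ 0 := by
    have := normSq_nonneg x
    positivity
  have hre (ζ : ℂ) (τ : ℝ) : (perp x ζ τ).re =
      (ζ.re - 2 * τ * x.re - (ζ.re * (x.re ^ 2 - x.im ^ 2) + ζ.im * (2 * x.re * x.im))) / 2 := by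
    simp [perp, pow_two, -mul_eq_mul_right_iff, -mul_eq_mul_left_iff]
    ring
  have him (ζ : ℂ) (τ : ℝ) : (perp x ζ τ).im =
      (ζ.im - 2 * τ * x.im - (ζ.re * (2 * x.re * x.im) - ζ.im * (x.re ^ 2 - x.im ^ 2))) / 2 := by
    simp [perp, pow_two, -mul_eq_mul_right_iff, -mul_eq_mul_left_iff]
    ring
  rw [← h₁, ← h₂, hre, him, hre, him]
  field_simp
  rw [normSq_apply]
  ring

theorem wirtinger_normSq_sub (a b : ℂ) :
    1 / 2 * (a - I * b) * conj (1 / 2 * (a - I * b)) -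
        1 / 2 * (a + I * b) * conj (1 / 2 * (a + I * b)) =
      ((a.re * b.im - a.im * b.re : ℝ) : ℂ) := by
  apply Complex.ext <;> simp <;> ring

theorem det_fderiv_Phi {F ξ : ℝ × ℝ → ℂ} (hF : ContDiff ℝ 1 F) (hξ : ContDiff ℝ 1 ξ)
    (w : ℝ × ℝ × ℝ) :
    (((fderiv ℝ (Phi F ξ) w).toLinearMap.det : ℝ) : ℂ) =
      4 * (dplus F ξ w.2.2 (w.1, w.2.1) * conj (dplus F ξ w.2.2 (w.1, w.2.1)) -
           dminus F ξ w.2.2 (w.1, w.2.1) * conj (dminus F ξ w.2.2 (w.1, w.2.1))) /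
        (1 + ξ (w.1, w.2.1) * conj (ξ (w.1, w.2.1))) ^ 2 := by
  set p : ℝ × ℝ := (w.1, w.2.1) with hp
  let g (v : ℝ × ℝ) : ℂ := fderiv ℝ F p v + w.2.2 * fderiv ℝ ξ p v -
    2 * F p * conj (ξ p) * fderiv ℝ ξ p v / (1 + ξ p * conj (ξ p))
  let ζ (v : ℝ × ℝ) : ℂ := zVel (F p) (ξ p) w.2.2 (fderiv ℝ F p v) (fderiv ℝ ξ p v) 0
  let τ (v : ℝ × ℝ) : ℂ := tVel (F p) (ξ p) w.2.2 (fderiv ℝ F p v) (fderiv ℝ ξ p v) 0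
  have hD := one_add_mul_conj_ne_zero (ξ p)
  have hτ (v : ℝ × ℝ) : ((τ v).re : ℂ) = τ v :=
    conj_eq_iff_re.1 (by simpa using conj_tVel (F p) (ξ p) (fderiv ℝ F p v) (fderiv ℝ ξ p v) w.2.2 0)
  have hg (v : ℝ × ℝ) : perp (ξ p) (ζ v) ((τ v).re : ℂ) = g v := by
    rw [hτ]
    exact perp_vel ..
  have hplus : dplus F ξ w.2.2 p = 1 / 2 * (g (1, 0) - I * g (0, 1)) := by
    simp only [dplus, wd, g]
    ring
  have hminus : dminus F ξ w.2.2 p = 1 / 2 * (g (1, 0) + I * g (0, 1)) := by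
    simp only [dminus, wdb, g]
    ring
  have hu : fderiv ℝ (Phi F ξ) w (1, 0, 0) = ((ζ (1, 0)).re, (ζ (1, 0)).im, (τ (1, 0)).re) :=
    fderiv_Phi_apply hF hξ w _ (by simp [ζ, hp]) (by simp [τ, hp])
  have hv : fderiv ℝ (Phi F ξ) w (0, 1, 0) = ((ζ (0, 1)).re, (ζ (0, 1)).im, (τ (0, 1)).re) :=
    fderiv_Phi_apply hF hξ w _ (by simp [ζ, hp]) (by simp [τ, hp])
  have hN : (1 : ℂ) + ξ p * conj (ξ p) = ((1 + normSq (ξ p) : ℝ) : ℂ) := by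
    rw [mul_conj]
    push_cast
    rfl
  have hr : fderiv ℝ (Phi F ξ) w (0, 0, 1) = (2 * (ξ p).re / (1 + normSq (ξ p)),
      2 * (ξ p).im / (1 + normSq (ξ p)), (1 - normSq (ξ p)) / (1 + normSq (ξ p))) := by
    have h00 : ((0, 0) : ℝ × ℝ) = 0 := rfl
    rw [fderiv_Phi_apply hF hξ w (0, 0, 1)
      (ζ := 2 * ξ p / (1 + normSq (ξ p) : ℝ))
      (τ := ((1 - normSq (ξ p)) / (1 + normSq (ξ p)) : ℝ))]
    · rw [ofReal_re, div_ofReal_re, div_ofReal_im]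
      simp
    · simp only [h00, map_zero, zVel, ← hp, ← hN, ofReal_one]
      field_simp
      ring
    · have h : (((1 - normSq (ξ p)) / (1 + normSq (ξ p)) : ℝ) : ℂ) =
          (1 - ξ p * conj (ξ p)) / (1 + ξ p * conj (ξ p)) := by
        rw [mul_conj]
        push_cast
        rfl
      simp only [h, h00, map_zero, tVel, ← hp, ofReal_one]
      rw [div_eq_div_iff (pow_ne_zero 3 hD) hD]
      ring
  rw [hplus, hminus, wirtinger_normSq_sub, hN, det_linearMap_prod_prod]
  simp only [ContinuousLinearMap.coe_coe, hu, hv, hr]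
  rw [triple_product_eq _ _ _ _ _ _ _ (hg (1, 0)) (hg (0, 1))]
  push_cast
  rfl

/-- The Jacobian determinant of Φ equals
Δ = 4(∂⁺F·conj(∂⁺F) − ∂⁻F·conj(∂⁻F))/(1+ξconj(ξ))², and Φ is a local diffeomorphism
wherever this is nonzero. -/
theorem jacobian_of_Phi
    (F ξ : ℝ × ℝ → ℂ) (hF : ContDiff ℝ 1 F) (hξ : ContDiff ℝ 1 ξ)
    (w : ℝ × ℝ × ℝ) :
    (((fderiv ℝ (Phi F ξ) w).toLinearMap.det : ℝ) : ℂ) =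
      4 * (dplus F ξ w.2.2 (w.1, w.2.1) * conj (dplus F ξ w.2.2 (w.1, w.2.1)) -
           dminus F ξ w.2.2 (w.1, w.2.1) * conj (dminus F ξ w.2.2 (w.1, w.2.1))) /
        (1 + ξ (w.1, w.2.1) * conj (ξ (w.1, w.2.1))) ^ 2 ∧
    (dplus F ξ w.2.2 (w.1, w.2.1) * conj (dplus F ξ w.2.2 (w.1, w.2.1)) ≠
        dminus F ξ w.2.2 (w.1, w.2.1) * conj (dminus F ξ w.2.2 (w.1, w.2.1)) →
      ∃ e : PartialHomeomorph (ℝ × ℝ × ℝ) (ℝ × ℝ × ℝ),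
        w ∈ e.source ∧ (∀ x ∈ e.source, e x = Phi F ξ x) ∧
        ContDiffOn ℝ 1 e e.source ∧ ContDiffOn ℝ 1 e.symm e.target) := by
  refine ⟨det_fderiv_Phi hF hξ w, fun hne => ?_⟩
  have hdet : (fderiv ℝ (Phi F ξ) w).det ≠ 0 := by
    rw [← ofReal_ne_zero]
    refine (det_fderiv_Phi hF hξ w).trans_ne ?_
    exact div_ne_zero (mul_ne_zero (by norm_num) (sub_ne_zero.2 hne))
      (pow_ne_zero 2 (one_add_mul_conj_ne_zero _))
  obtain ⟨e, hw, he, hcd, hcd'⟩ :=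
    exists_openPartialHomeomorph_of_det_ne_zero (contDiff_Phi hF hξ) hdet
  exact ⟨e.toPartialHomeomorph, hw, fun x _ => congrFun he x, hcd, hcd'⟩
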